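/- arXiv:0901.0749 — 2 statements merged into one kernel-verified Lean document; each statement's English description precedes it below -/
import Mathlib

section
/- Let Φ = (φ_{i,j}) ∈ ℝ^{m×N} and 1 ≤ K ≤ N. With D_SQ*(R) the optimal scalar distortion-rate function of the measurements of a random K-sparse Gaussian signal (defined in the context) and μ₂ := max over 1 ≤ i ≤ m and T ⊆ {1,…,N} with |T| = K of (m/K) ∑_{j∈T} φ_{i,j}², one has limsup_{R→∞} (2^{2R}/K) · D_SQ*(R) ≤ (π√3/2) · μ₂. -/
open MeasureTheory ProbabilityTheory Real Filter

/-- The expected distortion `D(C)` of scalar-quantizing, with the codebook `C`, the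
measurements `Y = ΦX` of a `K`-sparse signal whose support `T` is uniform over size-`K`
subsets of `{1,…,N}` and whose nonzero entries are i.i.d. standard Gaussian:
each coordinate `Y i` given `T` is centered Gaussian with variance `σ_{i,T}² = ∑_{j∈T} φ_{i,j}²`. -/
noncomputable def measDist {m N : ℕ} (Φ : Matrix (Fin m) (Fin N) ℝ) (K : ℕ)
    (C : Finset ℝ) (hC : C.Nonempty) : ℝ :=
  (1 / (N.choose K : ℝ)) *
    ∑ T ∈ Finset.powersetCard K (Finset.univ : Finset (Fin N)), ∑ i : Fin m,
      ∫ y, C.inf' hC (fun c => (y - c) ^ 2)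
        ∂(gaussianReal 0 (Real.toNNReal (∑ j ∈ T, (Φ i j) ^ 2)))

/-- The optimal scalar distortion-rate function `D_SQ*(R)` at rate `R` bits. -/
noncomputable def DSQ {m N : ℕ} (Φ : Matrix (Fin m) (Fin N) ℝ) (K : ℕ) (R : ℕ) : ℝ :=
  sInf {d : ℝ | ∃ (C : Finset ℝ) (hC : C.Nonempty), C.card ≤ 2 ^ R ∧
    d = measDist Φ K C hC}

/-- `μ₂ = max_{1 ≤ i ≤ m, |T| = K} (m/K) ∑_{j ∈ T} φ_{i,j}²`. -/
noncomputable def mu2 {m N : ℕ} (Φ : Matrix (Fin m) (Fin N) ℝ) (K : ℕ)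
    (hne : ((Finset.univ : Finset (Fin m)) ×ˢ
      Finset.powersetCard K (Finset.univ : Finset (Fin N))).Nonempty) : ℝ :=
  ((Finset.univ : Finset (Fin m)) ×ˢ
      Finset.powersetCard K (Finset.univ : Finset (Fin N))).sup' hne
    (fun p => ((m : ℝ) / (K : ℝ)) * ∑ j ∈ p.2, (Φ p.1 j) ^ 2)

open scoped NNReal ENNReal Topology

/-- A smooth distribution function `G` with positive density `g`, together with a measurable
quantile function `H`. -/
structure IsQuantilePair (g G H : ℝ → ℝ) : Prop where
  pos : ∀ y, 0 < g y
  hasDerivAt : ∀ y, HasDerivAt G (g y) y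
  mem_Ioo : ∀ y, G y ∈ Set.Ioo (0 : ℝ) 1
  right_inv : ∀ u ∈ Set.Ioo (0 : ℝ) 1, G (H u) = u
  measurable : Measurable H
  continuousOn : ContinuousOn H (Set.Ioo 0 1)

lemma hasDerivAt_cdf_gaussianReal {v : ℝ≥0} (hv : v ≠ 0) (y : ℝ) :
    HasDerivAt (cdf (gaussianReal 0 v)) (gaussianPDFReal 0 v y) y := by
  have hint := integrable_gaussianPDFReal 0 v
  have hcont : Continuous (gaussianPDFReal 0 v) := by
    unfold gaussianPDFReal; fun_prop
  have h1 : ∀ x, cdf (gaussianReal 0 v) x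
      = (∫ t in (0 : ℝ)..x, gaussianPDFReal 0 v t) + ∫ t in Set.Iic 0, gaussianPDFReal 0 v t := by
    intro x
    rw [← intervalIntegral.integral_Iic_sub_Iic hint.integrableOn hint.integrableOn, cdf_eq_real,
      measureReal_def, gaussianReal_apply_eq_integral _ hv, ENNReal.toReal_ofReal]
    · ring
    · exact integral_nonneg fun t => gaussianPDFReal_nonneg _ _ _
  have h2 := (hcont.integral_hasStrictDerivAt 0 y).hasDerivAt.add_const
    (∫ t in Set.Iic 0, gaussianPDFReal 0 v t)
  exact h2.congr_of_eventuallyEq (Eventually.of_forall h1)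

lemma exists_isQuantilePair_gaussianPDFReal {v : ℝ≥0} (hv : v ≠ 0) :
    ∃ G H, IsQuantilePair (gaussianPDFReal 0 v) G H := by
  let G : ℝ → ℝ := fun y => cdf (gaussianReal 0 v) y
  have hd : ∀ y, HasDerivAt G (gaussianPDFReal 0 v y) y := hasDerivAt_cdf_gaussianReal hv
  have hpos : ∀ y, 0 < gaussianPDFReal 0 v y := fun y => gaussianPDFReal_pos 0 v y hv
  have hmono : StrictMono G := strictMono_of_hasDerivAt_pos hd hpos
  have hcont : Continuous G := continuous_iff_continuousAt.2 fun y => (hd y).continuousAt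
  have h01 : ∀ y, G y ∈ Set.Ioo (0 : ℝ) 1 := fun y =>
    ⟨(cdf_nonneg _ (y - 1)).trans_lt (hmono (by linarith)),
      (hmono (show y < y + 1 by linarith)).trans_le (cdf_le_one _ _)⟩
  have hrange : Set.range G = Set.Ioo (0 : ℝ) 1 := by
    refine Set.Subset.antisymm (Set.range_subset_iff.2 h01) fun u hu => ?_
    have hbot := (tendsto_cdf_atBot (gaussianReal 0 v)).eventually (gt_mem_nhds hu.1)
    have htop := (tendsto_cdf_atTop (gaussianReal 0 v)).eventually (lt_mem_nhds hu.2)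
    obtain ⟨a, ha⟩ := hbot.exists
    obtain ⟨b, hb⟩ := htop.exists
    exact mem_range_of_exists_le_of_exists_ge hcont ⟨a, ha.le⟩ ⟨b, hb.le⟩
  let f : ℝ → Set.Ioo (0 : ℝ) 1 := fun y => ⟨G y, h01 y⟩
  have hf : StrictMono f := fun a b h => hmono h
  have hfs : Function.Surjective f := by
    rintro ⟨u, hu⟩
    obtain ⟨y, hy⟩ := hrange.ge hu
    exact ⟨y, Subtype.ext hy⟩
  let e := StrictMono.orderIsoOfSurjective f hf hfs
  have hec : Continuous e.symm := e.symm.continuous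
  classical
  refine ⟨G, fun u => if h : u ∈ Set.Ioo (0 : ℝ) 1 then e.symm ⟨u, h⟩ else 0, hpos, hd, h01,
    fun u hu => ?_, ?_, ?_⟩
  · have : f (e.symm ⟨u, hu⟩) = ⟨u, hu⟩ := e.apply_symm_apply ⟨u, hu⟩
    simpa [hu, f] using congrArg Subtype.val this
  · exact Measurable.dite hec.measurable (measurable_const (a := (0 : ℝ))) measurableSet_Ioo
  · rw [continuousOn_iff_continuous_domRestrict]
    convert hec using 1
    ext ⟨u, hu⟩
    simp only [Set.domRestrict_apply, hu, dite_true]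

namespace IsQuantilePair

variable {g G H : ℝ → ℝ}

lemma strictMono (h : IsQuantilePair g G H) : StrictMono G :=
  strictMono_of_hasDerivAt_pos h.hasDerivAt h.pos

lemma left_inv (h : IsQuantilePair g G H) (y : ℝ) : H (G y) = y :=
  h.strictMono.injective (h.right_inv _ (h.mem_Ioo y))

lemma hasDerivAt_quantile (h : IsQuantilePair g G H) (y : ℝ) :
    HasDerivAt H (g y)⁻¹ (G y) := by
  have hn : Set.Ioo (0 : ℝ) 1 ∈ 𝓝 (G y) := Ioo_mem_nhds (h.mem_Ioo y).1 (h.mem_Ioo y).2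
  refine HasDerivAt.of_local_left_inverse (f := G) (h.continuousOn.continuousAt hn) ?_
    (h.pos y).ne' (eventually_of_mem hn h.right_inv)
  rw [h.left_inv]
  exact h.hasDerivAt y

end IsQuantilePair

/-- The `n`-scaled squared distance from `y` to the nearest of the codepoints
`H ((k - θ) / n)`, `1 ≤ k ≤ n`. -/
noncomputable def ditheredDist (H : ℝ → ℝ) (n : ℕ) (θ y : ℝ) : ℝ≥0∞ :=
  ⨅ k : Fin n, ENNReal.ofReal ((n * (y - H (((k : ℕ) + 1 - θ) / n))) ^ 2)

lemma measurable_ditheredDist {H : ℝ → ℝ} (hH : Measurable H) (n : ℕ) :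
    Measurable fun p : ℝ × ℝ => ditheredDist H n p.1 p.2 := by
  unfold ditheredDist
  fun_prop

lemma ditheredDist_le {H : ℝ → ℝ} {n : ℕ} {θ y : ℝ} (k : ℤ) (hθ : θ ∈ Set.Ioo (0 : ℝ) 1)
    (hn : 0 < n) (hk : (k - θ) / n ∈ Set.Ioo (0 : ℝ) 1) :
    ditheredDist H n θ y ≤ ENNReal.ofReal ((n * (y - H ((k - θ) / n))) ^ 2) := by
  have hn' : (0 : ℝ) < n := by exact_mod_cast hn
  have h1 : (0 : ℝ) < k := by
    have := (div_pos_iff_of_pos_right hn').1 hk.1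
    linarith [hθ.1]
  have h2 : (k : ℝ) < n + 1 := by
    have := (div_lt_one hn').1 hk.2
    linarith [hθ.2]
  have h1' : 0 < k := by exact_mod_cast h1
  have h2' : k < n + 1 := by exact_mod_cast h2
  obtain ⟨j, hj⟩ : ∃ j : ℕ, k = j + 1 := ⟨(k - 1).toNat, by omega⟩
  subst hj
  refine (iInf_le _ (⟨j, by omega⟩ : Fin n)).trans (le_of_eq ?_)
  simp

lemma lintegral_sq_sub_round (a : ℝ) :
    ∫⁻ θ in Set.Ioo (0 : ℝ) 1, ENNReal.ofReal ((a + θ - round (a + θ)) ^ 2)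
      = ENNReal.ofReal (1 / 12) := by
  have hm : Measurable fun x : ℝ => (x - round x) ^ 2 := by
    have : Measurable fun x : ℝ => ((round x : ℤ) : ℝ) := by
      simp only [round_eq]
      fun_prop
    fun_prop
  have hb : ∀ x : ℝ, (x - round x) ^ 2 ≤ 1 := fun x => by
    have := abs_sub_round x
    rw [← sq_abs]
    nlinarith [abs_nonneg (x - round x)]
  have hper : Function.Periodic (fun x : ℝ => (x - round x) ^ 2) 1 := fun x => by
    simp
  rw [← ofReal_integral_eq_lintegral_ofReal]
  · congr 1
    rw [← integral_Ioc_eq_integral_Ioo, ← intervalIntegral.integral_of_le zero_le_one,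
      intervalIntegral.integral_comp_add_left (fun x : ℝ => (x - round x) ^ 2) a]
    rw [show a + 1 = (a + 0) + 1 by ring, hper.intervalIntegral_add_eq (a + 0) (-(1 / 2))]
    rw [intervalIntegral.integral_of_le (by norm_num), integral_Ioc_eq_integral_Ioo]
    rw [setIntegral_congr_fun (g := fun x : ℝ => x ^ 2) measurableSet_Ioo]
    · rw [← integral_Ioc_eq_integral_Ioo, ← intervalIntegral.integral_of_le (by norm_num),
        integral_pow]
      norm_num
    · intro x hx
      have : round x = 0 := by
        rw [round_eq_zero_iff]
        exact ⟨by linarith [hx.1], by linarith [hx.2]⟩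
      simp [this]
  · refine Measure.integrableOn_of_bounded (M := 1) (by simp)
      ((hm.comp (measurable_const_add a)).aestronglyMeasurable) ?_
    refine Eventually.of_forall fun x => ?_
    rw [Real.norm_of_nonneg (by positivity)]
    exact hb _
  · exact Eventually.of_forall fun x => by positivity

namespace IsQuantilePair

variable {g G H : ℝ → ℝ}

lemma eventually_lintegral_ditheredDist_le (h : IsQuantilePair g G H) (y : ℝ) {ε : ℝ}
    (hε : 0 < ε) :
    ∀ᶠ n : ℕ in atTop, ∫⁻ θ in Set.Ioo (0 : ℝ) 1, ditheredDist H n θ y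
      ≤ ENNReal.ofReal (((g y)⁻¹ + ε) ^ 2 / 12) := by
  have hL : 0 < (g y)⁻¹ := inv_pos.2 (h.pos y)
  have hnear : ∀ᶠ u in 𝓝 (G y), |H u - y| ≤ ((g y)⁻¹ + ε) * |u - G y| ∧
      u ∈ Set.Ioo (0 : ℝ) 1 := by
    refine ((hasDerivAt_iff_isLittleO.1 (h.hasDerivAt_quantile y)).bound hε).and
      (Ioo_mem_nhds (h.mem_Ioo y).1 (h.mem_Ioo y).2) |>.mono fun u hu => ⟨?_, hu.2⟩
    have h1 := hu.1
    simp only [h.left_inv, Real.norm_eq_abs, smul_eq_mul] at h1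
    have h2 : H u - y = (H u - y - (u - G y) * (g y)⁻¹) + (u - G y) * (g y)⁻¹ := by ring
    rw [h2]
    refine (abs_add_le _ _).trans ?_
    rw [abs_mul (u - G y), abs_of_pos hL]
    linarith
  obtain ⟨δ, hδ, hball⟩ := Metric.eventually_nhds_iff.1 hnear
  have hlim : Tendsto (fun n : ℕ => (1 / 2 : ℝ) / n) atTop (𝓝 0) :=
    tendsto_const_div_atTop_nhds_zero_nat _
  filter_upwards [hlim.eventually (gt_mem_nhds hδ), eventually_gt_atTop 0] with n hn hn0
  have hn' : (0 : ℝ) < n := by exact_mod_cast hn0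
  calc ∫⁻ θ in Set.Ioo (0 : ℝ) 1, ditheredDist H n θ y
      ≤ ∫⁻ θ in Set.Ioo (0 : ℝ) 1, ENNReal.ofReal (((g y)⁻¹ + ε) ^ 2) *
          ENNReal.ofReal ((n * G y + θ - round (n * G y + θ)) ^ 2) := by
        refine setLIntegral_mono' measurableSet_Ioo fun θ hθ => ?_
        set k := round (n * G y + θ)
        have hk : |n * G y + θ - k| ≤ 1 / 2 := abs_sub_round _
        have hdiff : ((k : ℝ) - θ) / n - G y = -(n * G y + θ - k) / n := by
          field_simp
          ring
        have hd : |((k : ℝ) - θ) / n - G y| = |n * G y + θ - k| / n := by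
          rw [hdiff, abs_div, abs_neg, abs_of_pos hn']
        obtain ⟨h1, h2⟩ := hball (y := ((k : ℝ) - θ) / n) (by
          rw [Real.dist_eq, hd]
          exact (div_le_div_of_nonneg_right hk hn'.le).trans_lt hn)
        refine (ditheredDist_le k hθ hn0 h2).trans ?_
        rw [← ENNReal.ofReal_mul (by positivity), ← mul_pow]
        refine ENNReal.ofReal_le_ofReal (sq_le_sq.2 ?_)
        rw [abs_mul, abs_mul, abs_of_pos hn', abs_of_pos (by positivity : 0 < (g y)⁻¹ + ε),
          abs_sub_comm]
        rw [hd] at h1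
        calc (n : ℝ) * |H (((k : ℝ) - θ) / n) - y|
            ≤ n * (((g y)⁻¹ + ε) * (|n * G y + θ - k| / n)) := by gcongr
          _ = ((g y)⁻¹ + ε) * |n * G y + θ - k| := by field_simp
    _ = ENNReal.ofReal (((g y)⁻¹ + ε) ^ 2 / 12) := by
        rw [lintegral_const_mul' _ _ ENNReal.ofReal_ne_top, lintegral_sq_sub_round,
          ← ENNReal.ofReal_mul (by positivity)]
        congr 1
        ring

lemma limsup_lintegral_ditheredDist_le (h : IsQuantilePair g G H) (y : ℝ) :
    limsup (fun n : ℕ => ∫⁻ θ in Set.Ioo (0 : ℝ) 1, ditheredDist H n θ y) atTop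
      ≤ ENNReal.ofReal (((g y)⁻¹) ^ 2 / 12) := by
  have hc : Tendsto (fun ε : ℝ => ENNReal.ofReal (((g y)⁻¹ + ε) ^ 2 / 12)) (𝓝[>] 0)
      (𝓝 (ENNReal.ofReal (((g y)⁻¹) ^ 2 / 12))) := by
    have : Continuous fun ε : ℝ => ENNReal.ofReal (((g y)⁻¹ + ε) ^ 2 / 12) :=
      ENNReal.continuous_ofReal.comp (by fun_prop)
    have h0 := this.tendsto 0
    rw [add_zero] at h0
    exact h0.mono_left nhdsWithin_le_nhds
  refine ge_of_tendsto hc (eventually_mem_nhdsWithin.mono fun ε hε => ?_)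
  exact limsup_le_of_le (by isBoundedDefault) (h.eventually_lintegral_ditheredDist_le y hε)

/-- Uniform domination: the inner codepoint adjacent to `y` is within `M / (n g(y))` of `y`. -/
lemma exists_forall_ditheredDist_le (h : IsQuantilePair g G H)
    (hcomp : ∀ a : ℝ, ∃ M : ℝ, ∀ x y, x ^ 2 ≤ a ^ 2 + y ^ 2 → g y ≤ M * g x) :
    ∃ M : ℝ, ∀ n : ℕ, 4 ≤ n → ∀ θ ∈ Set.Ioo (0 : ℝ) 1, ∀ y,
      ditheredDist H n θ y ≤ ENNReal.ofReal ((M * (g y)⁻¹) ^ 2) := by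
  set a := max |H (1 / 4)| |H (3 / 4)|
  obtain ⟨M, hM⟩ := hcomp a
  have hcont : Continuous G :=
    continuous_iff_continuousAt.2 fun y => (h.hasDerivAt y).continuousAt
  have hdiff : Differentiable ℝ G := fun y => (h.hasDerivAt y).differentiableAt
  have key : ∀ n : ℕ, 0 < n → ∀ y s t : ℝ, s ≤ t → G t - G s ≤ 1 / n →
      (∀ x ∈ Set.Icc s t, x ^ 2 ≤ a ^ 2 + y ^ 2) → 0 < M →
      n * (t - s) ≤ M * (g y)⁻¹ := by
    intro n hn y s t hst hG hx hMpos
    have hn' : (0 : ℝ) < n := by exact_mod_cast hn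
    have h1 := (convex_Icc s t).mul_sub_le_image_sub_of_le_deriv hcont.continuousOn
      hdiff.differentiableOn (C := g y / M) (fun x hxi => by
        rw [(h.hasDerivAt x).deriv, div_le_iff₀' hMpos]
        exact hM _ _ (hx x (interior_subset hxi))) s (Set.left_mem_Icc.2 hst) t
        (Set.right_mem_Icc.2 hst) hst
    have h2 := h1.trans hG
    have hg := h.pos y
    rw [← div_eq_mul_inv, le_div_iff₀ hg]
    rw [div_mul_eq_mul_div, div_le_div_iff₀ hMpos hn'] at h2
    linarith
  have hMpos : 0 < M := by
    have := hM 0 0 (by nlinarith [sq_nonneg a])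
    exact pos_of_mul_pos_left ((h.pos 0).trans_le this) (h.pos 0).le
  refine ⟨M, fun n hn θ hθ y => ?_⟩
  have hn0 : 0 < n := by omega
  have hn' : (4 : ℝ) ≤ n := by exact_mod_cast hn
  have hnpos : (0 : ℝ) < n := by linarith
  have hinv : 1 / (n : ℝ) ≤ 1 / 4 := one_div_le_one_div_of_le (by norm_num) hn'
  obtain ⟨hu0, hu1⟩ := h.mem_Ioo y
  have ha1 : |H (1 / 4)| ≤ a := le_max_left _ _
  have ha2 : |H (3 / 4)| ≤ a := le_max_right _ _
  have ha0 : 0 ≤ a := (abs_nonneg _).trans ha1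
  rcases le_total (1 / 2) (G y) with hu | hu
  · set k := ⌊n * G y + θ⌋
    have hk1 : (k : ℝ) ≤ n * G y + θ := Int.floor_le _
    have hk2 : n * G y + θ < k + 1 := Int.lt_floor_add_one _
    have hl : ((k : ℝ) - θ) / n ≤ G y := by
      rw [div_le_iff₀ hnpos]; linarith
    have hr : G y - 1 / n ≤ ((k : ℝ) - θ) / n := by
      rw [le_div_iff₀ hnpos, sub_mul, one_div, inv_mul_cancel₀ hnpos.ne']; linarith
    have hmem : ((k : ℝ) - θ) / n ∈ Set.Ioo (0 : ℝ) 1 := ⟨by linarith, by linarith⟩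
    refine (ditheredDist_le k hθ hn0 hmem).trans (ENNReal.ofReal_le_ofReal ?_)
    set c := H (((k : ℝ) - θ) / n)
    have hGc : G c = ((k : ℝ) - θ) / n := h.right_inv _ hmem
    have hcy : c ≤ y := h.strictMono.le_iff_le.1 (by rw [hGc]; exact hl)
    have hca : -a ≤ c := by
      have : H (1 / 4) ≤ c := h.strictMono.le_iff_le.1 (by
        rw [hGc, h.right_inv _ ⟨by norm_num, by norm_num⟩]; linarith)
      linarith [neg_abs_le (H (1 / 4))]
    have := key n hn0 y c y hcy (by rw [hGc]; linarith) (fun x hx => by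
      rcases le_total 0 x with h0 | h0
      · nlinarith [hx.2, sq_nonneg a]
      · nlinarith [hx.1, sq_nonneg y]) hMpos
    exact pow_le_pow_left₀ (mul_nonneg hnpos.le (by linarith)) this 2
  · set k := ⌈n * G y + θ⌉
    have hk1 : n * G y + θ ≤ k := Int.le_ceil _
    have hk2 : (k : ℝ) < n * G y + θ + 1 := Int.ceil_lt_add_one _
    have hl : G y ≤ ((k : ℝ) - θ) / n := by
      rw [le_div_iff₀ hnpos]; linarith
    have hr : ((k : ℝ) - θ) / n ≤ G y + 1 / n := by
      rw [div_le_iff₀ hnpos, add_mul, one_div, inv_mul_cancel₀ hnpos.ne']; linarith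
    have hmem : ((k : ℝ) - θ) / n ∈ Set.Ioo (0 : ℝ) 1 := ⟨by linarith, by linarith⟩
    refine (ditheredDist_le k hθ hn0 hmem).trans (ENNReal.ofReal_le_ofReal ?_)
    set c := H (((k : ℝ) - θ) / n)
    have hGc : G c = ((k : ℝ) - θ) / n := h.right_inv _ hmem
    have hcy : y ≤ c := h.strictMono.le_iff_le.1 (by rw [hGc]; exact hl)
    have hca : c ≤ a := by
      have : c ≤ H (3 / 4) := h.strictMono.le_iff_le.1 (by
        rw [hGc, h.right_inv _ ⟨by norm_num, by norm_num⟩]; linarith)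
      linarith [le_abs_self (H (3 / 4))]
    have := key n hn0 y y c hcy (by rw [hGc]; linarith) (fun x hx => by
      rcases le_total 0 x with h0 | h0
      · nlinarith [hx.2, sq_nonneg y]
      · nlinarith [hx.1, sq_nonneg a]) hMpos
    rw [show (n * (y - c)) ^ 2 = (n * (c - y)) ^ 2 by ring]
    exact pow_le_pow_left₀ (mul_nonneg hnpos.le (by linarith)) this 2

/-- Panter–Dite bound for the average distortion of a randomly shifted companding quantizer. -/
lemma limsup_lintegral_lintegral_ditheredDist_le (h : IsQuantilePair g G H)
    (hcomp : ∀ a : ℝ, ∃ M : ℝ, ∀ x y, x ^ 2 ≤ a ^ 2 + y ^ 2 → g y ≤ M * g x)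
    (ν : Measure ℝ) (hfin : ∫⁻ y, ENNReal.ofReal (((g y)⁻¹) ^ 2) ∂ν ≠ ∞) :
    limsup (fun n : ℕ => ∫⁻ y, (∫⁻ θ in Set.Ioo (0 : ℝ) 1, ditheredDist H n θ y) ∂ν) atTop
      ≤ ∫⁻ y, ENNReal.ofReal (((g y)⁻¹) ^ 2 / 12) ∂ν := by
  obtain ⟨M, hM⟩ := h.exists_forall_ditheredDist_le hcomp
  rw [← limsup_nat_add _ 4]
  refine (limsup_lintegral_le (fun y => ENNReal.ofReal ((M * (g y)⁻¹) ^ 2)) (fun n => ?_)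
    (fun n => Eventually.of_forall fun y => ?_) ?_).trans (lintegral_mono fun y => ?_)
  · exact ((measurable_ditheredDist h.measurable _).comp measurable_swap).lintegral_prod_right'
  · calc ∫⁻ θ in Set.Ioo (0 : ℝ) 1, ditheredDist H (n + 4) θ y
        ≤ ∫⁻ _ in Set.Ioo (0 : ℝ) 1, ENNReal.ofReal ((M * (g y)⁻¹) ^ 2) :=
          setLIntegral_mono' measurableSet_Ioo fun θ hθ => hM _ (by omega) θ hθ y
      _ = ENNReal.ofReal ((M * (g y)⁻¹) ^ 2) := by simp
  · simp_rw [mul_pow, ENNReal.ofReal_mul (sq_nonneg M)]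
    rw [lintegral_const_mul' _ _ ENNReal.ofReal_ne_top]
    exact ENNReal.mul_ne_top ENNReal.ofReal_ne_top hfin
  · rw [limsup_nat_add (fun n => ∫⁻ θ in Set.Ioo (0 : ℝ) 1, ditheredDist H n θ y) 4]
    exact h.limsup_lintegral_ditheredDist_le y

end IsQuantilePair

lemma gaussianPDFReal_le_exp_mul {v : ℝ≥0} (a x y : ℝ)
    (h : x ^ 2 ≤ a ^ 2 + y ^ 2) :
    gaussianPDFReal 0 v y ≤ Real.exp (a ^ 2 / (2 * v)) * gaussianPDFReal 0 v x := by
  simp only [gaussianPDFReal, sub_zero]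
  rw [mul_left_comm, ← Real.exp_add, ← add_div]
  gcongr
  linarith

lemma inv_gaussianPDFReal_sq {v : ℝ≥0} (y : ℝ) :
    ((gaussianPDFReal 0 v y)⁻¹) ^ 2 = 2 * π * v * Real.exp (y ^ 2 / v) := by
  simp only [gaussianPDFReal, sub_zero]
  rw [mul_inv, inv_inv, mul_pow, Real.sq_sqrt (by positivity), ← Real.exp_neg, ← Real.exp_nat_mul]
  congr 2
  push_cast
  rw [neg_div, neg_neg, ← mul_div_assoc, mul_div_mul_left _ _ two_ne_zero]

lemma lintegral_exp_sq_gaussianReal_le {s v : ℝ≥0} (hv : v ≠ 0) (hs : s ≤ v) :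
    ∫⁻ y, ENNReal.ofReal (Real.exp (y ^ 2 / (3 * v))) ∂(gaussianReal 0 s)
      ≤ ENNReal.ofReal √3 := by
  rcases eq_or_ne s 0 with rfl | hs0
  · rw [gaussianReal_zero_var, lintegral_dirac]
    refine ENNReal.ofReal_le_ofReal ?_
    simp
  have hvp : (0 : ℝ) < v := by positivity
  have hsp : (0 : ℝ) < s := by positivity
  have hsv : (s : ℝ) ≤ v := by exact_mod_cast hs
  set b : ℝ := 1 / (2 * s) - 1 / (3 * v) with hb
  have hbge : 1 / (6 * s : ℝ) ≤ b := by
    have h1 : 1 / (3 * v : ℝ) ≤ 1 / (3 * s) := by gcongr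
    have h2 : 1 / (2 * s : ℝ) - 1 / (3 * s) = 1 / (6 * s) := by field_simp; norm_num
    linarith
  have hbp : 0 < b := lt_of_lt_of_le (by positivity) hbge
  rw [gaussianReal_of_var_ne_zero _ hs0,
    lintegral_withDensity_eq_lintegral_mul _ (measurable_gaussianPDF 0 s) (by fun_prop)]
  have heq : ∀ y : ℝ, (gaussianPDF 0 s * fun y => ENNReal.ofReal (Real.exp (y ^ 2 / (3 * v)))) y
      = ENNReal.ofReal ((√(2 * π * s))⁻¹ * Real.exp (-b * y ^ 2)) := by
    intro y
    rw [Pi.mul_apply, gaussianPDF, ← ENNReal.ofReal_mul (gaussianPDFReal_nonneg _ _ _),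
      gaussianPDFReal, mul_assoc, ← Real.exp_add, hb]
    congr 3
    field_simp
    ring
  simp_rw [heq]
  rw [← ofReal_integral_eq_lintegral_ofReal ((integrable_exp_neg_mul_sq hbp).const_mul _)
    (Eventually.of_forall fun y => by positivity), integral_const_mul, integral_gaussian]
  refine ENNReal.ofReal_le_ofReal ?_
  rw [← Real.sqrt_inv, ← Real.sqrt_mul (by positivity)]
  refine Real.sqrt_le_sqrt ?_
  calc (2 * π * s)⁻¹ * (π / b) ≤ (2 * π * s)⁻¹ * (π / (1 / (6 * s))) := by gcongr
    _ = 3 := by field_simp; norm_num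

lemma lintegral_inv_gaussianPDFReal_sq_le {s v : ℝ≥0} (hv : v ≠ 0) (hs : s ≤ v) :
    ∫⁻ y, ENNReal.ofReal (((gaussianPDFReal 0 (3 * v) y)⁻¹) ^ 2) ∂(gaussianReal 0 s)
      ≤ ENNReal.ofReal (6 * π * √3 * v) := by
  simp_rw [inv_gaussianPDFReal_sq]
  simp only [NNReal.coe_mul, NNReal.coe_ofNat]
  have h0 : (0 : ℝ) ≤ 2 * π * (3 * v) := by positivity
  simp_rw [ENNReal.ofReal_mul h0]
  rw [lintegral_const_mul' _ _ ENNReal.ofReal_ne_top]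
  refine (mul_le_mul_right (lintegral_exp_sq_gaussianReal_le hv hs) _).trans (le_of_eq ?_)
  rw [← ENNReal.ofReal_mul h0]
  congr 1
  ring

/-- The sum, over all supports and all coordinates, of the conditional laws of a measurement. -/
noncomputable def measLaw {m N : ℕ} (Φ : Matrix (Fin m) (Fin N) ℝ) (K : ℕ) : Measure ℝ :=
  ∑ T ∈ Finset.powersetCard K (Finset.univ : Finset (Fin N)), ∑ i : Fin m,
    gaussianReal 0 (Real.toNNReal (∑ j ∈ T, (Φ i j) ^ 2))

lemma lintegral_measLaw {m N : ℕ} (Φ : Matrix (Fin m) (Fin N) ℝ) (K : ℕ) (f : ℝ → ℝ≥0∞) :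
    ∫⁻ y, f y ∂(measLaw Φ K) =
      ∑ T ∈ Finset.powersetCard K (Finset.univ : Finset (Fin N)), ∑ i : Fin m,
        ∫⁻ y, f y ∂(gaussianReal 0 (Real.toNNReal (∑ j ∈ T, (Φ i j) ^ 2))) := by
  simp only [measLaw, lintegral_finsetSum_measure]

instance {m N : ℕ} (Φ : Matrix (Fin m) (Fin N) ℝ) (K : ℕ) : IsFiniteMeasure (measLaw Φ K) := by
  refine ⟨?_⟩
  rw [← lintegral_one, lintegral_measLaw]
  simp [ENNReal.mul_lt_top_iff]

lemma measDist_nonneg {m N : ℕ} (Φ : Matrix (Fin m) (Fin N) ℝ) (K : ℕ) (C : Finset ℝ)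
    (hC : C.Nonempty) : 0 ≤ measDist Φ K C hC := by
  refine mul_nonneg (by positivity) (Finset.sum_nonneg fun T _ => Finset.sum_nonneg fun i _ =>
    integral_nonneg fun y => ?_)
  exact Finset.le_inf' _ _ fun c _ => sq_nonneg _

lemma DSQ_nonneg {m N : ℕ} (Φ : Matrix (Fin m) (Fin N) ℝ) (K R : ℕ) : 0 ≤ DSQ Φ K R := by
  refine Real.sInf_nonneg ?_
  rintro d ⟨C, hC, -, rfl⟩
  exact measDist_nonneg Φ K C hC

lemma DSQ_le_measDist {m N : ℕ} (Φ : Matrix (Fin m) (Fin N) ℝ) (K R : ℕ) (C : Finset ℝ)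
    (hC : C.Nonempty) (hcard : C.card ≤ 2 ^ R) : DSQ Φ K R ≤ measDist Φ K C hC := by
  refine csInf_le ⟨0, ?_⟩ ⟨C, hC, hcard, rfl⟩
  rintro d ⟨C', hC', -, rfl⟩
  exact measDist_nonneg Φ K C' hC'

lemma ofReal_mul_measDist_le {m N : ℕ} (Φ : Matrix (Fin m) (Fin N) ℝ) (K : ℕ) (C : Finset ℝ)
    (hC : C.Nonempty) {c : ℝ} (hc : 0 ≤ c) :
    ENNReal.ofReal (c * measDist Φ K C hC) ≤ ENNReal.ofReal (1 / (N.choose K : ℝ)) *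
      ∫⁻ y, ENNReal.ofReal (c * C.inf' hC fun x => (y - x) ^ 2) ∂(measLaw Φ K) := by
  have hpos : ∀ y : ℝ, 0 ≤ C.inf' hC fun x => (y - x) ^ 2 := fun y =>
    Finset.le_inf' _ _ fun c _ => sq_nonneg _
  have hcont : Continuous fun y : ℝ => C.inf' hC fun x => (y - x) ^ 2 :=
    Continuous.finset_inf'_apply hC fun x _ => by fun_prop
  have hterm : ∀ μ : Measure ℝ,
      ENNReal.ofReal (∫ y, C.inf' hC (fun x => (y - x) ^ 2) ∂μ)
        ≤ ∫⁻ y, ENNReal.ofReal (C.inf' hC fun x => (y - x) ^ 2) ∂μ := fun μ => by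
    rw [integral_eq_lintegral_of_nonneg_ae (Eventually.of_forall hpos)
      hcont.aestronglyMeasurable]
    exact ENNReal.ofReal_toReal_le
  simp_rw [ENNReal.ofReal_mul hc]
  rw [lintegral_const_mul' _ _ ENNReal.ofReal_ne_top, mul_left_comm, measDist,
    ENNReal.ofReal_mul (by positivity), lintegral_measLaw]
  gcongr
  rw [ENNReal.ofReal_sum_of_nonneg fun T _ => Finset.sum_nonneg fun i _ => integral_nonneg hpos]
  refine Finset.sum_le_sum fun T _ => ?_
  rw [ENNReal.ofReal_sum_of_nonneg fun i _ => integral_nonneg hpos]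
  exact Finset.sum_le_sum fun i _ => hterm _

lemma ofReal_mul_DSQ_le_lintegral_ditheredDist {m N : ℕ} (Φ : Matrix (Fin m) (Fin N) ℝ)
    (K R : ℕ) {n : ℕ} (hn : n = 2 ^ R) (H : ℝ → ℝ) (θ : ℝ) :
    ENNReal.ofReal ((n : ℝ) ^ 2 * DSQ Φ K R) ≤ ENNReal.ofReal (1 / (N.choose K : ℝ)) *
      ∫⁻ y, ditheredDist H n θ y ∂(measLaw Φ K) := by
  have hn0 : 0 < n := by rw [hn]; positivity
  set p : Fin n → ℝ := fun k => H (((k : ℕ) + 1 - θ) / (n : ℝ)) with hp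
  have hne : (Finset.univ.image p).Nonempty :=
    Finset.Nonempty.image ⟨⟨0, hn0⟩, Finset.mem_univ _⟩ p
  have hcard : (Finset.univ.image p).card ≤ 2 ^ R := by
    simpa [← hn] using Finset.card_image_le (s := Finset.univ) (f := p)
  refine (ENNReal.ofReal_le_ofReal (mul_le_mul_of_nonneg_left
    (DSQ_le_measDist Φ K R _ hne hcard) (sq_nonneg _))).trans
    ((ofReal_mul_measDist_le Φ K _ hne (sq_nonneg _)).trans ?_)
  refine mul_le_mul_right (lintegral_mono fun y => ?_) _
  refine le_iInf fun k => ENNReal.ofReal_le_ofReal ?_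
  rw [mul_pow]
  exact mul_le_mul_of_nonneg_left (Finset.inf'_le (fun x => (y - x) ^ 2)
    (Finset.mem_image_of_mem p (Finset.mem_univ k))) (sq_nonneg _)

lemma ofReal_mul_DSQ_le {m N : ℕ} (Φ : Matrix (Fin m) (Fin N) ℝ) (K R : ℕ) {n : ℕ}
    (hn : n = 2 ^ R) {H : ℝ → ℝ} (hH : Measurable H) :
    ENNReal.ofReal ((n : ℝ) ^ 2 * DSQ Φ K R) ≤ ENNReal.ofReal (1 / (N.choose K : ℝ)) *
      ∫⁻ y, (∫⁻ θ in Set.Ioo (0 : ℝ) 1, ditheredDist H n θ y) ∂(measLaw Φ K) := by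
  have hmeas : Measurable (Function.uncurry fun y θ => ditheredDist H n θ y) := by
    unfold ditheredDist Function.uncurry
    fun_prop
  calc ENNReal.ofReal ((n : ℝ) ^ 2 * DSQ Φ K R)
      = ∫⁻ _ in Set.Ioo (0 : ℝ) 1, ENNReal.ofReal ((n : ℝ) ^ 2 * DSQ Φ K R) := by simp
    _ ≤ ∫⁻ θ in Set.Ioo (0 : ℝ) 1, ENNReal.ofReal (1 / (N.choose K : ℝ)) *
          ∫⁻ y, ditheredDist H n θ y ∂(measLaw Φ K) :=
        lintegral_mono (ofReal_mul_DSQ_le_lintegral_ditheredDist Φ K R hn H)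
    _ = ENNReal.ofReal (1 / (N.choose K : ℝ)) *
          ∫⁻ θ in Set.Ioo (0 : ℝ) 1, ∫⁻ y, ditheredDist H n θ y ∂(measLaw Φ K) :=
        lintegral_const_mul' _ _ ENNReal.ofReal_ne_top
    _ = _ := by rw [lintegral_lintegral_swap hmeas.aemeasurable]

lemma lintegral_measLaw_le {m N K : ℕ} (Φ : Matrix (Fin m) (Fin N) ℝ) {f : ℝ → ℝ≥0∞} {b : ℝ}
    (hf : ∀ T ∈ Finset.powersetCard K (Finset.univ : Finset (Fin N)), ∀ i : Fin m,
      ∫⁻ y, f y ∂(gaussianReal 0 (Real.toNNReal (∑ j ∈ T, (Φ i j) ^ 2))) ≤ ENNReal.ofReal b) :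
    ∫⁻ y, f y ∂(measLaw Φ K) ≤ ENNReal.ofReal (N.choose K * (m * b)) := by
  rw [lintegral_measLaw]
  refine (Finset.sum_le_sum fun T hT => Finset.sum_le_sum fun i _ => hf T hT i).trans
    (le_of_eq ?_)
  simp [ENNReal.ofReal_mul, Finset.card_powersetCard]

/-- The asymptotic distortion bound in terms of any positive upper bound `v` on the conditional
variances of the measurements. -/
lemma eventually_mul_DSQ_lt {m N K : ℕ} (Φ : Matrix (Fin m) (Fin N) ℝ) (hKN : K ≤ N)
    {v : ℝ≥0} (hv : v ≠ 0)
    (hΦ : ∀ T ∈ Finset.powersetCard K (Finset.univ : Finset (Fin N)), ∀ i : Fin m,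
      ∑ j ∈ T, (Φ i j) ^ 2 ≤ v) {b : ℝ} (hb : π * √3 / 2 * (m * v) < b) :
    ∀ᶠ R : ℕ in atTop, 2 ^ (2 * R) * DSQ Φ K R < b := by
  have hv3 : 3 * v ≠ 0 := mul_ne_zero (by norm_num) hv
  obtain ⟨G, H, h⟩ := exists_isQuantilePair_gaussianPDFReal hv3
  have hchoose : (0 : ℝ) < N.choose K := by exact_mod_cast Nat.choose_pos hKN
  have hint : ∫⁻ y, ENNReal.ofReal (((gaussianPDFReal 0 (3 * v) y)⁻¹) ^ 2) ∂(measLaw Φ K)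
      ≤ ENNReal.ofReal (N.choose K * (m * (6 * π * √3 * v))) :=
    lintegral_measLaw_le Φ fun T hT i =>
      lintegral_inv_gaussianPDFReal_sq_le hv (Real.toNNReal_le_iff_le_coe.2 (hΦ T hT i))
  have hlim := h.limsup_lintegral_lintegral_ditheredDist_le
    (fun a => ⟨_, gaussianPDFReal_le_exp_mul a⟩) (measLaw Φ K)
    (hint.trans_lt ENNReal.ofReal_lt_top).ne
  have hB : ∫⁻ y, ENNReal.ofReal (((gaussianPDFReal 0 (3 * v) y)⁻¹) ^ 2 / 12) ∂(measLaw Φ K)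
      ≤ ENNReal.ofReal (N.choose K * (π * √3 / 2 * (m * v))) := by
    simp_rw [div_eq_inv_mul _ (12 : ℝ)]
    simp_rw [ENNReal.ofReal_mul (show (0 : ℝ) ≤ 12⁻¹ by norm_num)]
    rw [lintegral_const_mul' _ _ ENNReal.ofReal_ne_top]
    refine (mul_le_mul_right hint _).trans (le_of_eq ?_)
    rw [← ENNReal.ofReal_mul (by norm_num)]
    congr 1
    ring
  have hbpos : 0 < b := lt_of_le_of_lt (by positivity) hb
  have hlt : ENNReal.ofReal (N.choose K * (π * √3 / 2 * (m * v)))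
      < ENNReal.ofReal (N.choose K * b) :=
    (ENNReal.ofReal_lt_ofReal_iff (by positivity)).2 (by gcongr)
  have hev := eventually_lt_of_limsup_lt ((hlim.trans hB).trans_lt hlt)
  have hpow : Tendsto (fun R : ℕ => 2 ^ R) atTop atTop := tendsto_pow_atTop_atTop_of_one_lt
    one_lt_two
  filter_upwards [hpow.eventually hev] with R hR
  have h1 := (ofReal_mul_DSQ_le Φ K R rfl h.measurable).trans_lt
    ((ENNReal.mul_lt_mul_iff_right (by simpa using hchoose.ne') ENNReal.ofReal_ne_top).2 hR)
  rw [← ENNReal.ofReal_mul (by positivity), ← mul_assoc, one_div,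
    inv_mul_cancel₀ hchoose.ne', one_mul, Nat.cast_pow, Nat.cast_ofNat, ← pow_mul'] at h1
  exact (ENNReal.ofReal_lt_ofReal_iff hbpos).1 h1

/-- Theorem 2, upper bound of equation (11):
`limsup_{R→∞} (2^{2R}/K) D_SQ*(R) ≤ (π√3/2) μ₂`. -/
theorem stmt3 {m N K : ℕ} (Φ : Matrix (Fin m) (Fin N) ℝ)
    (hm : 1 ≤ m) (hK1 : 1 ≤ K) (hKN : K ≤ N) :
    Filter.limsup (fun R : ℕ => (2 : ℝ) ^ (2 * R) / (K : ℝ) * DSQ Φ K R) Filter.atTop ≤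
      π * Real.sqrt 3 / 2 *
        mu2 Φ K (Finset.Nonempty.product ⟨⟨0, hm⟩, Finset.mem_univ _⟩
          (Finset.powersetCard_nonempty.2 (by simpa using hKN))) := by
  set μ := mu2 Φ K (Finset.Nonempty.product ⟨⟨0, hm⟩, Finset.mem_univ _⟩
    (Finset.powersetCard_nonempty.2 (by simpa using hKN))) with hμ
  have hmp : (0 : ℝ) < m := by exact_mod_cast hm
  have hKp : (0 : ℝ) < K := by exact_mod_cast hK1
  have hle : ∀ T ∈ Finset.powersetCard K (Finset.univ : Finset (Fin N)), ∀ i : Fin m,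
      (m : ℝ) / K * ∑ j ∈ T, (Φ i j) ^ 2 ≤ μ := fun T hT i =>
    Finset.le_sup' (fun p : Fin m × Finset (Fin N) => (m : ℝ) / K * ∑ j ∈ p.2, (Φ p.1 j) ^ 2)
      (Finset.mk_mem_product (Finset.mem_univ i) hT)
  have hμ0 : 0 ≤ μ := by
    obtain ⟨T, hT⟩ : (Finset.powersetCard K (Finset.univ : Finset (Fin N))).Nonempty :=
      Finset.powersetCard_nonempty.2 (by simpa using hKN)
    exact le_trans (by positivity) (hle T hT ⟨0, hm⟩)
  refine le_of_forall_gt_imp_ge_of_dense fun b hb => ?_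
  have hc : 0 < π * √3 / 2 := by positivity
  obtain ⟨ε, hε, hεb⟩ : ∃ ε > 0, π * √3 / 2 * (μ + ε) < b := by
    rw [mul_comm, ← lt_div_iff₀ hc] at hb
    refine ⟨(b / (π * √3 / 2) - μ) / 2, by linarith, ?_⟩
    rw [mul_comm, ← lt_div_iff₀ hc]
    linarith
  set v : ℝ≥0 := ⟨(K : ℝ) / m * (μ + ε), by positivity⟩
  have hvval : (v : ℝ) = (K : ℝ) / m * (μ + ε) := rfl
  have hv : v ≠ 0 := by
    rw [← NNReal.coe_ne_zero, hvval]
    positivity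
  have hev := eventually_mul_DSQ_lt Φ hKN hv (b := K * b) (fun T hT i => by
    rw [hvval, div_mul_eq_mul_div, le_div_iff₀ hmp]
    have := hle T hT i
    rw [div_mul_eq_mul_div, div_le_iff₀ hKp] at this
    nlinarith) (by
    rw [hvval]
    calc π * √3 / 2 * (m * (K / m * (μ + ε))) = K * (π * √3 / 2 * (μ + ε)) := by field_simp
      _ < K * b := by gcongr)
  refine limsup_le_of_le (isCoboundedUnder_le_of_le atTop (x := 0) fun R =>
    mul_nonneg (by positivity) (DSQ_nonneg Φ K R)) (hev.mono fun R hR => ?_)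
  rw [div_mul_eq_mul_div, div_le_iff₀ hKp]
  linarith
end

section
/- Let σ > 0 and let γ_{σ²} be the centered Gaussian measure on ℝ with variance σ². Define D*(R) := inf { ∫_ℝ min_{ω∈C} (y − ω)² dγ_{σ²}(y) : C ⊆ ℝ finite nonempty, |C| ≤ 2^R } for R ∈ ℕ. Then lim_{R→∞} 2^{2R} · D*(R) = (π√3/2) · σ². -/
open MeasureTheory ProbabilityTheory Real Filter

/-- The optimal scalar distortion-rate function at rate `R` bits of the centered
Gaussian source on `ℝ` with variance `σ²`:
`D*(R) = inf { ∫ min_{ω ∈ C} (y - ω)² dγ_{σ²}(y) : C ⊆ ℝ finite nonempty, |C| ≤ 2^R }`. -/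
noncomputable def DstarGauss (σ : ℝ) (R : ℕ) : ℝ :=
  sInf {d : ℝ | ∃ (C : Finset ℝ) (hC : C.Nonempty), C.card ≤ 2 ^ R ∧
    d = ∫ y, C.inf' hC (fun c => (y - c) ^ 2) ∂(gaussianReal 0 (Real.toNNReal (σ ^ 2)))}

/-- The squared distance from `y` to the nearest point of the codebook `C`. -/
noncomputable def nearestSq (C : Finset ℝ) (hC : C.Nonempty) (y : ℝ) : ℝ :=
  C.inf' hC (fun c => (y - c) ^ 2)

lemma nearestSq_le {C : Finset ℝ} (hC : C.Nonempty) {c : ℝ} (hc : c ∈ C) (y : ℝ) :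
    nearestSq C hC y ≤ (y - c) ^ 2 :=
  Finset.inf'_le (fun c => (y - c) ^ 2) hc

lemma exists_nearestSq_eq {C : Finset ℝ} (hC : C.Nonempty) (y : ℝ) :
    ∃ c ∈ C, nearestSq C hC y = (y - c) ^ 2 :=
  Finset.exists_mem_eq_inf' hC _

lemma nearestSq_nonneg {C : Finset ℝ} (hC : C.Nonempty) (y : ℝ) : 0 ≤ nearestSq C hC y := by
  obtain ⟨c, -, h⟩ := exists_nearestSq_eq hC y
  rw [h]; positivity

lemma continuous_nearestSq {C : Finset ℝ} (hC : C.Nonempty) : Continuous (nearestSq C hC) :=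
  Continuous.finset_inf'_apply hC (fun c _ => by fun_prop)

lemma integrable_nearestSq_mul {g : ℝ → ℝ} (hg : Continuous g) (hpos : ∀ x, 0 < g x)
    (hint : ∀ c, Integrable (fun y => (y - c) ^ 2 * g y ^ 3)) {C : Finset ℝ} (hC : C.Nonempty) :
    Integrable (fun y => nearestSq C hC y * g y ^ 3) := by
  obtain ⟨c, hc⟩ := id hC
  refine (hint c).mono' ((continuous_nearestSq hC).mul (hg.pow 3)).aestronglyMeasurable
    (Eventually.of_forall fun y => ?_)
  have h3 : 0 < g y ^ 3 := pow_pos (hpos y) 3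
  rw [Real.norm_of_nonneg (mul_nonneg (nearestSq_nonneg hC y) h3.le)]
  exact mul_le_mul_of_nonneg_right (nearestSq_le hC hc y) h3.le

lemma exists_ratio_bound {g : ℝ → ℝ} (hg : Continuous g) (hpos : ∀ x, 0 < g x) (A : ℝ) {ρ : ℝ}
    (hρ : 1 < ρ) : ∃ δ > 0, ∀ x ∈ Set.Icc (-A) A, ∀ y ∈ Set.Icc (-A) A, |x - y| < δ →
      g x ≤ ρ * g y := by
  have hu : UniformContinuousOn (fun x => Real.log (g x)) (Set.Icc (-A) A) :=
    isCompact_Icc.uniformContinuousOn_of_continuous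
      (hg.log fun x => (hpos x).ne').continuousOn
  obtain ⟨δ, hδ, h⟩ := Metric.uniformContinuousOn_iff.1 hu (Real.log ρ) (Real.log_pos hρ)
  refine ⟨δ, hδ, fun x hx y hy hxy => ?_⟩
  have h1 := h x hx y hy hxy
  rw [Real.dist_eq] at h1
  have h2 := (abs_lt.1 h1).2
  rw [← Real.log_le_log_iff (hpos x) (mul_pos (by linarith) (hpos y)),
    Real.log_mul (by linarith) (hpos y).ne']
  linarith

lemma exists_pos_le_on_Icc {g : ℝ → ℝ} (hg : Continuous g) (hpos : ∀ x, 0 < g x) (A : ℝ) :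
    ∃ m > 0, ∀ x ∈ Set.Icc (-A) A, m ≤ g x := by
  rcases (Set.Icc (-A) A).eq_empty_or_nonempty with h | h
  · exact ⟨1, one_pos, by simp [h]⟩
  · obtain ⟨x, -, hx⟩ := isCompact_Icc.exists_isMinOn h hg.continuousOn
    exact ⟨g x, hpos x, hx⟩

lemma integral_parabola (f q c r : ℝ) :
    ∫ y in (c - r)..(c + r), (f - (y - c) ^ 2 * q) = 2 * r * f - 2 / 3 * r ^ 3 * q := by
  have h := intervalIntegral.integral_comp_sub_right (a := c - r) (b := c + r)
    (fun s : ℝ => f - s ^ 2 * q) c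
  rw [h, intervalIntegral.integral_sub (by simp)
    (Continuous.intervalIntegrable (by fun_prop) _ _)]
  simp [intervalIntegral.integral_mul_const, integral_pow]
  ring

/-- The Lagrangian gain of a single codebook point. -/
lemma exists_single_point_bound {g : ℝ → ℝ} (hg : Continuous g) (hpos : ∀ x, 0 < g x) (A : ℝ)
    {ρ : ℝ} (hρ : 1 < ρ) : ∃ τ₀ > 0, ∀ τ, 0 < τ → τ < τ₀ → ∀ c,
      ∫ y in Set.Icc (-A) A, max (τ ^ 2 * g y - (y - c) ^ 2 * g y ^ 3) 0
        ≤ 4 / 3 * τ ^ 3 * ρ ^ 3 := by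
  obtain ⟨δ, hδ, hratio⟩ := exists_ratio_bound hg hpos A hρ
  obtain ⟨m, hm, hmin⟩ := exists_pos_le_on_Icc hg hpos A
  have hρ0 : 0 < ρ := by linarith
  refine ⟨δ * m / 2, by positivity, fun τ hτ hτδ c => ?_⟩
  have key : ∀ y, (0 < τ ^ 2 * g y - (y - c) ^ 2 * g y ^ 3) → |y - c| * g y < τ := by
    intro y hy
    have hgy := hpos y
    have : (|y - c| * g y) ^ 2 < τ ^ 2 := by
      rw [mul_pow, sq_abs]
      have : 0 < g y * (τ ^ 2 - (y - c) ^ 2 * g y ^ 2) := by linarith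
      have := pos_of_mul_pos_right this hgy.le
      linarith
    exact lt_of_pow_lt_pow_left₀ 2 hτ.le this
  have near : ∀ y ∈ Set.Icc (-A) A, |y - c| * g y < τ → |y - c| < δ / 2 := by
    intro y hy h
    have h1 : |y - c| * m ≤ |y - c| * g y :=
      mul_le_mul_of_nonneg_left (hmin y hy) (abs_nonneg _)
    have h2 : |y - c| * m < δ / 2 * m := by linarith
    exact lt_of_mul_lt_mul_right h2 hm.le
  by_cases hex : ∃ y₀ ∈ Set.Icc (-A) A, 0 < τ ^ 2 * g y₀ - (y₀ - c) ^ 2 * g y₀ ^ 3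
  · obtain ⟨y₀, hy₀, hy₀'⟩ := hex
    have hn₀ := near y₀ hy₀ (key y₀ hy₀')
    set G := g y₀ with hG
    have hGpos : 0 < G := hpos y₀
    set r := τ * ρ ^ 2 / G with hr
    have hrpos : 0 < r := by positivity
    have hindnn : ∀ y, 0 ≤ (Set.Ioc (c - r) (c + r)).indicator
        (fun y => τ ^ 2 * (G * ρ) - (y - c) ^ 2 * (G / ρ) ^ 3) y := by
      intro y
      refine Set.indicator_nonneg (fun x hx => ?_) y
      have hxr : (x - c) ^ 2 ≤ r ^ 2 := by
        apply sq_le_sq'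
        · linarith [hx.1]
        · linarith [hx.2]
      have h1 : r ^ 2 * (G / ρ) ^ 3 = τ ^ 2 * (G * ρ) := by
        rw [hr]; field_simp
      have h2 : (x - c) ^ 2 * (G / ρ) ^ 3 ≤ r ^ 2 * (G / ρ) ^ 3 :=
        mul_le_mul_of_nonneg_right hxr (by positivity)
      linarith
    have hpt : ∀ y ∈ Set.Icc (-A) A, max (τ ^ 2 * g y - (y - c) ^ 2 * g y ^ 3) 0 ≤
        (Set.Ioc (c - r) (c + r)).indicator
          (fun y => τ ^ 2 * (G * ρ) - (y - c) ^ 2 * (G / ρ) ^ 3) y ∨ y = c - r := by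
      intro y hy
      by_cases hyc : y = c - r
      · exact Or.inr hyc
      left
      by_cases hp : 0 < τ ^ 2 * g y - (y - c) ^ 2 * g y ^ 3
      · have hn := near y hy (key y hp)
        have hd : |y - y₀| < δ := by
          have := abs_sub_le y c y₀
          rw [abs_sub_comm c y₀] at this
          linarith
        have hu : g y ≤ ρ * G := hratio y hy y₀ hy₀ hd
        have hl : G ≤ ρ * g y := hratio y₀ hy₀ y hy (by rwa [abs_sub_comm])
        have hl' : G / ρ ≤ g y := by rw [div_le_iff₀ hρ0]; linarith
        have hle : τ ^ 2 * g y - (y - c) ^ 2 * g y ^ 3 ≤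
            τ ^ 2 * (G * ρ) - (y - c) ^ 2 * (G / ρ) ^ 3 := by
          have h3 : (G / ρ) ^ 3 ≤ g y ^ 3 := pow_le_pow_left₀ (by positivity) hl' 3
          have h4 := mul_le_mul_of_nonneg_left h3 (sq_nonneg (y - c))
          have h5 := mul_le_mul_of_nonneg_left hu (sq_nonneg τ)
          linarith
        have habs : |y - c| ≤ r := by
          rw [hr, le_div_iff₀ hGpos]
          have h6 := key y hp
          have h7 : |y - c| * G ≤ |y - c| * (ρ * g y) :=
            mul_le_mul_of_nonneg_left hl (abs_nonneg _)
          have h8 : ρ * (|y - c| * g y) ≤ ρ * τ := mul_le_mul_of_nonneg_left h6.le hρ0.le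
          have h9 : ρ * τ ≤ ρ ^ 2 * τ := mul_le_mul_of_nonneg_right (by nlinarith) hτ.le
          linarith
        have habs' := abs_le.1 habs
        have hmem : y ∈ Set.Ioc (c - r) (c + r) :=
          ⟨lt_of_le_of_ne (by linarith) (Ne.symm hyc), by linarith⟩
        rw [Set.indicator_of_mem hmem, max_eq_left hp.le]
        exact hle
      · rw [max_eq_right (not_lt.1 hp)]
        exact hindnn y
    have hcont : Continuous (fun y : ℝ => τ ^ 2 * (G * ρ) - (y - c) ^ 2 * (G / ρ) ^ 3) := by
      fun_prop
    have hindint : Integrable ((Set.Ioc (c - r) (c + r)).indicator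
        (fun y => τ ^ 2 * (G * ρ) - (y - c) ^ 2 * (G / ρ) ^ 3)) :=
      (integrable_indicator_iff measurableSet_Ioc).2
        (hcont.integrableOn_Icc.mono_set Set.Ioc_subset_Icc_self)
    calc ∫ y in Set.Icc (-A) A, max (τ ^ 2 * g y - (y - c) ^ 2 * g y ^ 3) 0
        ≤ ∫ y in Set.Icc (-A) A, (Set.Ioc (c - r) (c + r)).indicator
          (fun y => τ ^ 2 * (G * ρ) - (y - c) ^ 2 * (G / ρ) ^ 3) y := by
          refine integral_mono_ae (Continuous.integrableOn_Icc (by fun_prop))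
            hindint.integrableOn ?_
          have hne : ∀ᵐ y ∂(volume.restrict (Set.Icc (-A) A)), y ≠ c - r :=
            ae_restrict_of_ae (Measure.ae_ne volume (c - r))
          filter_upwards [hne, ae_restrict_mem measurableSet_Icc] with y h1 h2
          exact (hpt y h2).resolve_right h1
      _ ≤ ∫ y, (Set.Ioc (c - r) (c + r)).indicator
          (fun y => τ ^ 2 * (G * ρ) - (y - c) ^ 2 * (G / ρ) ^ 3) y :=
          setIntegral_le_integral hindint (Eventually.of_forall hindnn)
      _ = 2 * r * (τ ^ 2 * (G * ρ)) - 2 / 3 * r ^ 3 * (G / ρ) ^ 3 := by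
          rw [integral_indicator measurableSet_Ioc,
            ← intervalIntegral.integral_of_le (by linarith), integral_parabola]
      _ = 4 / 3 * τ ^ 3 * ρ ^ 3 := by
          rw [hr]; field_simp; ring
  · push Not at hex
    have h0 : ∫ y in Set.Icc (-A) A, max (τ ^ 2 * g y - (y - c) ^ 2 * g y ^ 3) 0 =
        ∫ y in Set.Icc (-A) A, (0 : ℝ) :=
      setIntegral_congr_fun measurableSet_Icc fun y hy => max_eq_right (hex y hy)
    rw [h0]
    simp only [integral_zero]
    positivity

lemma lagrangian_lower_bound {g : ℝ → ℝ} (hg : Continuous g) (hpos : ∀ x, 0 < g x)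
    (hint : ∀ c, Integrable (fun y => (y - c) ^ 2 * g y ^ 3)) {A τ b : ℝ}
    (hb : ∀ c, ∫ y in Set.Icc (-A) A, max (τ ^ 2 * g y - (y - c) ^ 2 * g y ^ 3) 0 ≤ b)
    (hb0 : 0 ≤ b) {C : Finset ℝ} (hC : C.Nonempty) {N : ℕ} (hN : C.card ≤ N) :
    τ ^ 2 * (∫ y in Set.Icc (-A) A, g y) - N * b ≤ ∫ y, nearestSq C hC y * g y ^ 3 := by
  have hci : ∀ c, IntegrableOn (fun y => max (τ ^ 2 * g y - (y - c) ^ 2 * g y ^ 3) 0)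
      (Set.Icc (-A) A) := fun c => Continuous.integrableOn_Icc (by fun_prop)
  have hgi : IntegrableOn (fun y => τ ^ 2 * g y) (Set.Icc (-A) A) :=
    Continuous.integrableOn_Icc (by fun_prop)
  have hsi : IntegrableOn (fun y => ∑ c ∈ C, max (τ ^ 2 * g y - (y - c) ^ 2 * g y ^ 3) 0)
      (Set.Icc (-A) A) := integrable_finsetSum _ fun c _ => hci c
  have hni := integrable_nearestSq_mul hg hpos hint hC
  have hsum : ∫ y in Set.Icc (-A) A, ∑ c ∈ C, max (τ ^ 2 * g y - (y - c) ^ 2 * g y ^ 3) 0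
      ≤ N * b := by
    rw [integral_finsetSum _ fun c _ => hci c]
    calc _ ≤ ∑ c ∈ C, b := Finset.sum_le_sum fun c _ => hb c
      _ = C.card * b := by simp
      _ ≤ N * b := mul_le_mul_of_nonneg_right (by exact_mod_cast hN) hb0
  calc τ ^ 2 * (∫ y in Set.Icc (-A) A, g y) - N * b
      ≤ (∫ y in Set.Icc (-A) A, τ ^ 2 * g y) -
        ∫ y in Set.Icc (-A) A, ∑ c ∈ C, max (τ ^ 2 * g y - (y - c) ^ 2 * g y ^ 3) 0 := by
        rw [integral_const_mul]; linarith
    _ = ∫ y in Set.Icc (-A) A, (τ ^ 2 * g y -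
        ∑ c ∈ C, max (τ ^ 2 * g y - (y - c) ^ 2 * g y ^ 3) 0) := (integral_sub hgi hsi).symm
    _ ≤ ∫ y in Set.Icc (-A) A, nearestSq C hC y * g y ^ 3 := by
        refine integral_mono (hgi.sub hsi) hni.integrableOn fun y => ?_
        obtain ⟨c, hc, h⟩ := exists_nearestSq_eq hC y
        have h1 := Finset.single_le_sum
          (f := fun c => max (τ ^ 2 * g y - (y - c) ^ 2 * g y ^ 3) 0)
          (fun c _ => le_max_right _ _) hc
        have h2 := le_max_left (τ ^ 2 * g y - (y - c) ^ 2 * g y ^ 3) 0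
        simp only at h1 ⊢
        rw [h]
        linarith
    _ ≤ ∫ y, nearestSq C hC y * g y ^ 3 :=
        setIntegral_le_integral hni (Eventually.of_forall fun y =>
          mul_nonneg (nearestSq_nonneg hC y) (pow_pos (hpos y) 3).le)

lemma eventually_lower_bound_aux {g : ℝ → ℝ} (hg : Continuous g) (hpos : ∀ x, 0 < g x)
    (hint : ∀ c, Integrable (fun y => (y - c) ^ 2 * g y ^ 3)) {A ρ : ℝ} (hA : 0 < A)
    (hρ : 1 < ρ) : ∀ᶠ N : ℕ in atTop, ∀ (C : Finset ℝ) (hC : C.Nonempty), C.card ≤ N →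
      (∫ y in (-A)..A, g y) ^ 3 / (12 * ρ ^ 6) ≤
        (N : ℝ) ^ 2 * ∫ y, nearestSq C hC y * g y ^ 3 := by
  obtain ⟨τ₀, hτ₀, hb⟩ := exists_single_point_bound hg hpos A hρ
  set S := ∫ y in (-A)..A, g y with hS
  have hSpos : 0 < S := intervalIntegral.intervalIntegral_pos_of_pos
    (hg.intervalIntegrable _ _) hpos (by linarith)
  have hρ0 : 0 < ρ := by linarith
  have hlim : Tendsto (fun N : ℕ => S / (2 * ρ ^ 3) / (N : ℝ)) atTop (nhds 0) :=
    tendsto_const_div_atTop_nhds_zero_nat _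
  filter_upwards [hlim.eventually_lt_const hτ₀, eventually_gt_atTop 0] with N hN hN0 C hC hcard
  have hNr : (0 : ℝ) < N := by exact_mod_cast hN0
  set τ := S / (2 * ρ ^ 3) / (N : ℝ) with hτ
  have hτpos : 0 < τ := by positivity
  have h := lagrangian_lower_bound hg hpos hint (hb τ hτpos hN) (by positivity) hC hcard
  rw [integral_Icc_eq_integral_Ioc, ← intervalIntegral.integral_of_le (by linarith), ← hS] at h
  have h' := mul_le_mul_of_nonneg_left h (sq_nonneg (N : ℝ))
  refine le_trans (le_of_eq ?_) h'
  rw [hτ]; field_simp; ring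

lemma eventually_lower_bound {g : ℝ → ℝ} (hg : Continuous g) (hpos : ∀ x, 0 < g x)
    (hgi : Integrable g) (hint : ∀ c, Integrable (fun y => (y - c) ^ 2 * g y ^ 3)) {L : ℝ}
    (hL : L < (∫ y, g y) ^ 3 / 12) :
    ∀ᶠ N : ℕ in atTop, ∀ (C : Finset ℝ) (hC : C.Nonempty), C.card ≤ N →
      L < (N : ℝ) ^ 2 * ∫ y, nearestSq C hC y * g y ^ 3 := by
  have h1 : Tendsto (fun A : ℝ => ∫ y in (-A)..A, g y) atTop (nhds (∫ y, g y)) :=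
    intervalIntegral_tendsto_integral hgi tendsto_neg_atTop_atBot tendsto_id
  have h2 : Tendsto (fun A : ℝ => 1 + A⁻¹) atTop (nhds 1) := by
    simpa using tendsto_inv_atTop_zero.const_add (1 : ℝ)
  have h3 : Tendsto (fun A : ℝ => (∫ y in (-A)..A, g y) ^ 3 / (12 * (1 + A⁻¹) ^ 6)) atTop
      (nhds ((∫ y, g y) ^ 3 / 12)) := by
    have := (h1.pow 3).div ((h2.pow 6).const_mul 12) (by norm_num)
    simp only [one_pow, mul_one] at this
    exact this
  obtain ⟨A, hA, hA0⟩ := ((h3.eventually_const_lt hL).and (eventually_gt_atTop 0)).exists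
  have hρ : 1 < 1 + A⁻¹ := by linarith [inv_pos.2 hA0]
  filter_upwards [eventually_lower_bound_aux hg hpos hint hA0 hρ] with N hN C hC hcard
  exact hA.trans_le (hN C hC hcard)

lemma exists_cumulative {g : ℝ → ℝ} (hg : Continuous g) (hgi : Integrable g) :
    ∃ G : ℝ → ℝ, Continuous G ∧ (∀ a b, ∫ x in a..b, g x = G b - G a) ∧
      Tendsto G atBot (nhds 0) ∧ Tendsto G atTop (nhds (∫ x, g x)) := by
  have hii : ∀ a b, IntervalIntegrable g volume a b := fun a b => hg.intervalIntegrable a b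
  refine ⟨fun y => (∫ x in Set.Iic 0, g x) + ∫ x in (0 : ℝ)..y, g x, ?_, fun a b => ?_, ?_, ?_⟩
  · exact continuous_const.add (intervalIntegral.continuous_primitive hii 0)
  · rw [← intervalIntegral.integral_interval_sub_left (hii 0 b) (hii 0 a)]; ring
  · have h := (intervalIntegral_tendsto_integral_Iic (0 : ℝ) hgi.integrableOn
      (tendsto_id (α := ℝ) (x := atBot))).const_sub (∫ x in Set.Iic 0, g x)
    rw [sub_self] at h
    refine h.congr fun y => ?_
    rw [intervalIntegral.integral_symm y 0, id]; ring
  · have h := (intervalIntegral_tendsto_integral_Ioi (0 : ℝ) hgi.integrableOn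
      (tendsto_id (α := ℝ) (x := atTop))).const_add (∫ x in Set.Iic 0, g x)
    rwa [intervalIntegral.integral_Iic_add_Ioi hgi.integrableOn hgi.integrableOn] at h

lemma integral_nearestSq_cell_le {g : ℝ → ℝ} (hg : Continuous g) (hpos : ∀ x, 0 < g x)
    {C : Finset ℝ} (hC : C.Nonempty) {a b M : ℝ} (hab : a ≤ b) (ha : a ∈ C) (hb : b ∈ C)
    (hM : ∀ y ∈ Set.Icc a b, g y ^ 3 ≤ M) :
    ∫ y in a..b, nearestSq C hC y * g y ^ 3 ≤ M * (b - a) ^ 3 / 12 := by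
  have hcont : Continuous (fun y => nearestSq C hC y * g y ^ 3) :=
    (continuous_nearestSq hC).mul (hg.pow 3)
  have hhalf : ∀ c ∈ C, ∀ u v, a ≤ u → u ≤ v → v ≤ b →
      ∫ y in u..v, nearestSq C hC y * g y ^ 3 ≤ ((v - c) ^ 3 - (u - c) ^ 3) / 3 * M := by
    intro c hc u v hau huv hvb
    calc ∫ y in u..v, nearestSq C hC y * g y ^ 3 ≤ ∫ y in u..v, (y - c) ^ 2 * M := by
          refine intervalIntegral.integral_mono_on huv (hcont.intervalIntegrable _ _)
            (Continuous.intervalIntegrable (by fun_prop) _ _) fun y hy => ?_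
          exact mul_le_mul (nearestSq_le hC hc y) (hM y ⟨hau.trans hy.1, hy.2.trans hvb⟩)
            (pow_pos (hpos y) 3).le (sq_nonneg _)
      _ = ((v - c) ^ 3 - (u - c) ^ 3) / 3 * M := by
          have h := intervalIntegral.integral_comp_sub_right (a := u) (b := v)
            (fun s : ℝ => s ^ 2 * M) c
          rw [h, intervalIntegral.integral_mul_const, integral_pow]
          norm_num
  rw [← intervalIntegral.integral_add_adjacent_intervals
    (hcont.intervalIntegrable a ((a + b) / 2)) (hcont.intervalIntegrable ((a + b) / 2) b)]
  have h1 := hhalf a ha a ((a + b) / 2) le_rfl (by linarith) (by linarith)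
  have h2 := hhalf b hb ((a + b) / 2) b (by linarith) (by linarith) le_rfl
  refine (add_le_add h1 h2).trans (le_of_eq ?_)
  ring

/-- The codebook of quantiles of the density `g`, together with the origin. -/
lemma exists_quantile_codebook {g G : ℝ → ℝ} {S : ℝ} (hg : Continuous g) (hpos : ∀ x, 0 < g x)
    (hanti : AntitoneOn g (Set.Ici 0)) (hmono : MonotoneOn g (Set.Iic 0))
    (hGc : Continuous G) (hGg : ∀ a b, ∫ x in a..b, g x = G b - G a) (hGm : StrictMono G)
    (hG0 : Tendsto G atBot (nhds 0)) (hGS : Tendsto G atTop (nhds S)) (hS : 0 < S) {N : ℕ}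
    (hN : 0 < N) :
    ∃ (a : ℕ → ℝ) (C : Finset ℝ) (hC : C.Nonempty), C.card ≤ N ∧
      (∀ k, k + 1 < N → a k ∈ C ∧ G (a k) = S * ((k + 1 : ℕ) : ℝ) / N) ∧
      ∀ y, nearestSq C hC y * g y ^ 2 ≤ (S / N) ^ 2 := by
  have hNr : (0 : ℝ) < N := by exact_mod_cast hN
  have hGpos : ∀ y, 0 < G y := fun y =>
    (hGm.monotone.le_of_tendsto hG0 (y - 1)).trans_lt (hGm (by linarith))
  have hGle : ∀ y, G y ≤ S := fun y => hGm.monotone.ge_of_tendsto hGS y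
  have hex : ∀ k : ℕ, ∃ x, k + 1 < N → G x = S * ((k + 1 : ℕ) : ℝ) / N := by
    intro k
    by_cases hk : k + 1 < N
    · have hkr : ((k + 1 : ℕ) : ℝ) < N := by exact_mod_cast hk
      have hk0 : (0 : ℝ) < ((k + 1 : ℕ) : ℝ) := by positivity
      have h1 : S * ((k + 1 : ℕ) : ℝ) / N < S := by
        rw [div_lt_iff₀ hNr]; exact mul_lt_mul_of_pos_left hkr hS
      have h0 : 0 < S * ((k + 1 : ℕ) : ℝ) / N := by positivity
      obtain ⟨x, hx⟩ := mem_range_of_exists_le_of_exists_ge hGc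
        ((hG0.eventually_lt_const h0).exists.imp fun _ h => h.le)
        ((hGS.eventually_const_lt h1).exists.imp fun _ h => h.le)
      exact ⟨x, fun _ => hx⟩
    · exact ⟨0, fun h => absurd h hk⟩
  choose a ha using hex
  have hC : (insert 0 ((Finset.range (N - 1)).image a)).Nonempty := Finset.insert_nonempty _ _
  have hmem : ∀ k, k + 1 < N → a k ∈ insert 0 ((Finset.range (N - 1)).image a) := fun k hk =>
    Finset.mem_insert_of_mem (Finset.mem_image_of_mem _ (Finset.mem_range.2 (by omega)))
  refine ⟨a, _, hC, ?_, fun k hk => ⟨hmem k hk, ha k hk⟩, fun y => ?_⟩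
  · have h1 := Finset.card_insert_le 0 ((Finset.range (N - 1)).image a)
    have h2 := Finset.card_image_le (s := Finset.range (N - 1)) (f := a)
    rw [Finset.card_range] at h2
    omega
  have hquant : ∀ t, 0 < t → t + S / N ≤ S →
      ∃ k, k + 1 < N ∧ t ≤ G (a k) ∧ G (a k) < t + S / N := by
    intro t ht htS
    have hpos' : 0 < t * N / S := by positivity
    have h1 := Nat.le_ceil (t * N / S)
    have h2 := Nat.ceil_lt_add_one hpos'.le
    obtain ⟨k, hk⟩ := Nat.exists_eq_succ_of_ne_zero (Nat.ceil_pos.2 hpos').ne'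
    rw [hk, Nat.succ_eq_add_one] at h1 h2
    rw [div_le_iff₀ hS] at h1
    have h2' : ((k + 1 : ℕ) : ℝ) * S < t * N + S := by
      have := mul_lt_mul_of_pos_right h2 hS
      rwa [add_mul, div_mul_cancel₀ _ hS.ne', one_mul] at this
    have h3 : t + S / N = (t * N + S) / N := by field_simp
    have hkN : k + 1 < N := by
      rw [h3, div_le_iff₀ hNr] at htS
      have : ((k + 1 : ℕ) : ℝ) * S < N * S := by linarith
      exact_mod_cast lt_of_mul_lt_mul_right this hS.le
    refine ⟨k, hkN, ?_, ?_⟩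
    · rw [ha k hkN, le_div_iff₀ hNr]; linarith
    · rw [ha k hkN, h3]
      exact div_lt_div_of_pos_right (by linarith) hNr
  have hright : ∀ c, 0 ≤ c → c ≤ y → (y - c) * g y ≤ G y - G c := by
    intro c hc hcy
    rw [← hGg, ← smul_eq_mul, ← intervalIntegral.integral_const]
    exact intervalIntegral.integral_mono_on hcy (by simp) (hg.intervalIntegrable _ _)
      fun x hx => hanti (hc.trans hx.1) (hc.trans hcy) hx.2
  have hleft : ∀ c, c ≤ 0 → y ≤ c → (c - y) * g y ≤ G c - G y := by
    intro c hc hcy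
    rw [← hGg, ← smul_eq_mul, ← intervalIntegral.integral_const]
    exact intervalIntegral.integral_mono_on hcy (by simp) (hg.intervalIntegrable _ _)
      fun x hx => hmono (hcy.trans hc) (hx.2.trans hc) hx.1
  have hclose : ∃ c ∈ insert 0 ((Finset.range (N - 1)).image a), |y - c| * g y ≤ S / N := by
    rcases le_total 0 y with hy | hy
    · rcases le_or_gt (G y - G 0) (S / N) with h | h
      · refine ⟨0, Finset.mem_insert_self _ _, ?_⟩
        rw [abs_of_nonneg (by linarith)]
        exact (hright 0 le_rfl hy).trans h
      · obtain ⟨k, hk, h1, h2⟩ := hquant (G y - S / N) (by linarith [hGpos 0])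
          (by linarith [hGle y])
        have hcy : a k ≤ y := hGm.le_iff_le.1 (by linarith)
        have hc0 : 0 ≤ a k := hGm.le_iff_le.1 (by linarith)
        refine ⟨a k, hmem k hk, ?_⟩
        rw [abs_of_nonneg (by linarith)]
        linarith [hright (a k) hc0 hcy]
    · rcases le_or_gt (G 0 - G y) (S / N) with h | h
      · refine ⟨0, Finset.mem_insert_self _ _, ?_⟩
        rw [abs_sub_comm, abs_of_nonneg (by linarith)]
        exact (hleft 0 le_rfl hy).trans h
      · obtain ⟨k, hk, h1, h2⟩ := hquant (G y) (hGpos y) (by linarith [hGle 0])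
        have hcy : y ≤ a k := hGm.le_iff_le.1 (by linarith)
        have hc0 : a k ≤ 0 := hGm.le_iff_le.1 (by linarith)
        refine ⟨a k, hmem k hk, ?_⟩
        rw [abs_sub_comm, abs_of_nonneg (by linarith)]
        linarith [hleft (a k) hc0 hcy]
  obtain ⟨c, hc, hcS⟩ := hclose
  calc nearestSq _ hC y * g y ^ 2 ≤ (y - c) ^ 2 * g y ^ 2 :=
        mul_le_mul_of_nonneg_right (nearestSq_le hC hc y) (sq_nonneg _)
    _ = (|y - c| * g y) ^ 2 := by rw [mul_pow, sq_abs]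
    _ ≤ (S / N) ^ 2 := pow_le_pow_left₀ (mul_nonneg (abs_nonneg _) (hpos y).le) hcS 2

lemma eventually_upper_bound_aux {g : ℝ → ℝ} (hg : Continuous g) (hpos : ∀ x, 0 < g x)
    (hgi : Integrable g) (hint : ∀ c, Integrable (fun y => (y - c) ^ 2 * g y ^ 3))
    (hanti : AntitoneOn g (Set.Ici 0)) (hmono : MonotoneOn g (Set.Iic 0)) {A ρ : ℝ} (hA : 0 < A)
    (hρ : 1 < ρ) : ∀ᶠ N : ℕ in atTop, ∃ (C : Finset ℝ) (hC : C.Nonempty), C.card ≤ N ∧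
      (N : ℝ) ^ 2 * ∫ y, nearestSq C hC y * g y ^ 3 ≤
        ρ ^ 6 * (∫ y, g y) ^ 3 / 12 + (∫ y, g y) ^ 2 * ((∫ y, g y) - ∫ y in (-A)..A, g y) := by
  obtain ⟨G, hGc, hGg, hG0, hGS⟩ := exists_cumulative hg hgi
  set S := ∫ y, g y with hSdef
  have hGm : StrictMono G := fun x y hxy => by
    have := intervalIntegral.intervalIntegral_pos_of_pos (hg.intervalIntegrable x y) hpos hxy
    rw [hGg] at this
    linarith
  have hGpos : ∀ y, 0 < G y := fun y =>
    (hGm.monotone.le_of_tendsto hG0 (y - 1)).trans_lt (hGm (by linarith))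
  have hGlt : ∀ y, G y < S := fun y =>
    (hGm (by linarith : y < y + 1)).trans_le (hGm.monotone.ge_of_tendsto hGS (y + 1))
  have hS : 0 < S := (hGpos 0).trans (hGlt 0)
  obtain ⟨δ, hδ, hratio⟩ := exists_ratio_bound hg hpos (A + 1) hρ
  obtain ⟨m, hm, hmin⟩ := exists_pos_le_on_Icc hg hpos (A + 1)
  have hρ0 : 0 < ρ := by linarith
  have hlim : Tendsto (fun N : ℕ => S / (N : ℝ)) atTop (nhds 0) :=
    tendsto_const_div_atTop_nhds_zero_nat _
  filter_upwards [hlim.eventually_lt_const (hGpos (-A)),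
    hlim.eventually_lt_const (sub_pos.2 (hGlt A)),
    hlim.eventually_lt_const (sub_pos.2 (hGm (by linarith : A < A + 1))),
    hlim.eventually_lt_const (sub_pos.2 (hGm (by linarith : -(A + 1) < -A))),
    hlim.eventually_lt_const (mul_pos hδ hm), eventually_ge_atTop 2]
    with N hN1 hN2 hN3 hN4 hN5 hN6
  obtain ⟨n, rfl⟩ := Nat.exists_eq_add_of_le' hN6
  obtain ⟨a, C, hC, hcard, haC, hdom⟩ := exists_quantile_codebook hg hpos hanti hmono hGc hGg hGm
    hG0 hGS hS (N := n + 2) (by omega)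
  refine ⟨C, hC, hcard, ?_⟩
  have hNr : (0 : ℝ) < ((n + 2 : ℕ) : ℝ) := by positivity
  set N : ℝ := ((n + 2 : ℕ) : ℝ) with hNdef
  set h := S / N with hh
  have hhpos : 0 < h := by positivity
  set T : ℝ → ℝ := (Set.Ioc (-A) A)ᶜ.indicator g with hT
  have hTi : Integrable T := hgi.indicator measurableSet_Ioc.compl
  have hTint : ∫ y, T y = S - ∫ y in (-A)..A, g y := by
    rw [hT, integral_indicator measurableSet_Ioc.compl,
      intervalIntegral.integral_of_le (by linarith), eq_sub_iff_add_eq, add_comm]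
    exact integral_add_compl measurableSet_Ioc hgi
  have hTnn : ∀ y, 0 ≤ T y := Set.indicator_nonneg fun y _ => (hpos y).le
  have hni := integrable_nearestSq_mul hg hpos hint hC
  have hfi : Integrable (fun y => nearestSq C hC y * g y ^ 3 - h ^ 2 * T y) :=
    hni.sub (hTi.const_mul _)
  have hTout : ∀ y, y ∉ Set.Ioc (-A) A → nearestSq C hC y * g y ^ 3 - h ^ 2 * T y ≤ 0 := by
    intro y hy
    have h1 := mul_le_mul_of_nonneg_right (hdom y) (hpos y).le
    rw [hT, Set.indicator_of_mem (Set.mem_compl hy)]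
    linarith
  have hGa : ∀ k, k < n + 1 → G (a k) = h * ((k + 1 : ℕ) : ℝ) := by
    intro k hk
    rw [(haC k (by omega)).2, hh]
    ring
  have hcell : ∀ k < n, ∫ y in (a k)..(a (k + 1)),
      (nearestSq C hC y * g y ^ 3 - h ^ 2 * T y) ≤ ρ ^ 6 * h ^ 3 / 12 := by
    intro k hk
    have hka := hGa k (by omega)
    have hkb := hGa (k + 1) (by omega)
    have hdiff : G (a (k + 1)) = G (a k) + h := by rw [hka, hkb]; push_cast; ring
    have hab : a k < a (k + 1) := hGm.lt_iff_lt.1 (by linarith)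
    by_cases hmeet : ∃ y₀ ∈ Set.Icc (a k) (a (k + 1)), y₀ ∈ Set.Ioc (-A) A
    · obtain ⟨y₀, hy₀, hy₀A⟩ := hmeet
      have g1 := hGm.monotone hy₀.1
      have g2 := hGm.monotone hy₀.2
      have g3 := hGm.monotone hy₀A.1.le
      have g4 := hGm.monotone hy₀A.2
      have hb1 : a (k + 1) < A + 1 := hGm.lt_iff_lt.1 (by linarith)
      have ha1 : -(A + 1) < a k := hGm.lt_iff_lt.1 (by linarith)
      have hlow : ∀ u, (∀ x ∈ Set.Icc (a k) (a (k + 1)), u ≤ g x) →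
          (a (k + 1) - a k) * u ≤ h := by
        intro u hu
        have h1 : ∫ x in (a k)..(a (k + 1)), u ≤ ∫ x in (a k)..(a (k + 1)), g x :=
          intervalIntegral.integral_mono_on hab.le (by simp) (hg.intervalIntegrable _ _) hu
        rw [hGg, intervalIntegral.integral_const, smul_eq_mul] at h1
        linarith
      have hsub : ∀ x ∈ Set.Icc (a k) (a (k + 1)), x ∈ Set.Icc (-(A + 1)) (A + 1) :=
        fun x hx => ⟨by linarith [hx.1], by linarith [hx.2]⟩
      have hlen : a (k + 1) - a k < δ := by
        have := hlow m fun x hx => hmin x (hsub x hx)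
        exact lt_of_mul_lt_mul_right (this.trans_lt hN5) hm.le
      have hleft : a k ∈ Set.Icc (a k) (a (k + 1)) := ⟨le_rfl, hab.le⟩
      set g₀ := g (a k) with hg₀
      have hg₀pos : 0 < g₀ := hpos _
      have hup : ∀ x ∈ Set.Icc (a k) (a (k + 1)), g x ≤ ρ * g₀ := fun x hx =>
        hratio x (hsub x hx) _ (hsub _ hleft) (by
          rw [abs_of_nonneg (by linarith [hx.1])]; linarith [hx.2])
      have hdn : ∀ x ∈ Set.Icc (a k) (a (k + 1)), g₀ / ρ ≤ g x := fun x hx => by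
        rw [div_le_iff₀ hρ0, mul_comm]
        exact hratio _ (hsub _ hleft) x (hsub x hx) (by
          rw [abs_sub_comm, abs_of_nonneg (by linarith [hx.1])]; linarith [hx.2])
      have hℓ : (a (k + 1) - a k) * g₀ ≤ ρ * h := by
        have := mul_le_mul_of_nonneg_left (hlow _ hdn) hρ0.le
        calc (a (k + 1) - a k) * g₀ = ρ * ((a (k + 1) - a k) * (g₀ / ρ)) := by field_simp
          _ ≤ ρ * h := this
      calc ∫ y in (a k)..(a (k + 1)), (nearestSq C hC y * g y ^ 3 - h ^ 2 * T y)
          ≤ ∫ y in (a k)..(a (k + 1)), nearestSq C hC y * g y ^ 3 :=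
            intervalIntegral.integral_mono_on hab.le hfi.intervalIntegrable
              hni.intervalIntegrable fun y _ => by
                have := mul_nonneg (sq_nonneg h) (hTnn y)
                linarith
        _ ≤ (ρ * g₀) ^ 3 * (a (k + 1) - a k) ^ 3 / 12 :=
            integral_nearestSq_cell_le hg hpos hC hab.le (haC k (by omega)).1
              (haC (k + 1) (by omega)).1
              fun y hy => pow_le_pow_left₀ (hpos y).le (hup y hy) 3
        _ = ρ ^ 3 * ((a (k + 1) - a k) * g₀) ^ 3 / 12 := by ring
        _ ≤ ρ ^ 3 * (ρ * h) ^ 3 / 12 := by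
            have := pow_le_pow_left₀ (mul_nonneg (by linarith) hg₀pos.le) hℓ 3
            gcongr
        _ = ρ ^ 6 * h ^ 3 / 12 := by ring
    · push Not at hmeet
      calc ∫ y in (a k)..(a (k + 1)), (nearestSq C hC y * g y ^ 3 - h ^ 2 * T y)
          ≤ ∫ y in (a k)..(a (k + 1)), (0 : ℝ) :=
            intervalIntegral.integral_mono_on hab.le hfi.intervalIntegrable (by simp)
              fun y hy => hTout y (hmeet y hy)
        _ ≤ ρ ^ 6 * h ^ 3 / 12 := by
            rw [intervalIntegral.integral_zero]; positivity
  have ha0 : a 0 < -A := hGm.lt_iff_lt.1 (by rw [hGa 0 (by omega)]; simpa using hN1)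
  have han : A < a n := hGm.lt_iff_lt.1 (by
    rw [hGa n (by omega)]
    have : h * N = S := by rw [hh]; field_simp
    rw [hNdef] at this
    push_cast at this ⊢
    linarith)
  have htotal : ∫ y, (nearestSq C hC y * g y ^ 3 - h ^ 2 * T y) ≤ N * (ρ ^ 6 * h ^ 3 / 12) := by
    rw [← integral_add_compl (measurableSet_Ioc (a := a 0) (b := a n)) hfi,
      ← intervalIntegral.integral_of_le (by linarith),
      ← intervalIntegral.sum_integral_adjacent_intervals fun k _ => hfi.intervalIntegrable]
    have h1 : ∫ y in (Set.Ioc (a 0) (a n))ᶜ, (nearestSq C hC y * g y ^ 3 - h ^ 2 * T y) ≤ 0 :=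
      setIntegral_nonpos measurableSet_Ioc.compl fun y hy => hTout y fun hyA =>
        hy ⟨ha0.trans hyA.1, hyA.2.trans han.le⟩
    have h2 := Finset.sum_le_sum fun k hk => hcell k (Finset.mem_range.1 hk)
    rw [Finset.sum_const, Finset.card_range, nsmul_eq_mul] at h2
    have h3 : (n : ℝ) * (ρ ^ 6 * h ^ 3 / 12) ≤ N * (ρ ^ 6 * h ^ 3 / 12) :=
      mul_le_mul_of_nonneg_right (by rw [hNdef]; push_cast; linarith) (by positivity)
    linarith
  rw [integral_sub hni (hTi.const_mul _), integral_const_mul, hTint] at htotal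
  have hfin := mul_le_mul_of_nonneg_left
    (sub_le_iff_le_add.1 htotal) (sq_nonneg N)
  refine hfin.trans (le_of_eq ?_)
  rw [hh]; field_simp

lemma eventually_upper_bound {g : ℝ → ℝ} (hg : Continuous g) (hpos : ∀ x, 0 < g x)
    (hgi : Integrable g) (hint : ∀ c, Integrable (fun y => (y - c) ^ 2 * g y ^ 3))
    (hanti : AntitoneOn g (Set.Ici 0)) (hmono : MonotoneOn g (Set.Iic 0)) {U : ℝ}
    (hU : (∫ y, g y) ^ 3 / 12 < U) :
    ∀ᶠ N : ℕ in atTop, ∃ (C : Finset ℝ) (hC : C.Nonempty), C.card ≤ N ∧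
      (N : ℝ) ^ 2 * ∫ y, nearestSq C hC y * g y ^ 3 < U := by
  have h1 : Tendsto (fun A : ℝ => ∫ y in (-A)..A, g y) atTop (nhds (∫ y, g y)) :=
    intervalIntegral_tendsto_integral hgi tendsto_neg_atTop_atBot tendsto_id
  have h2 : Tendsto (fun A : ℝ => 1 + A⁻¹) atTop (nhds 1) := by
    simpa using tendsto_inv_atTop_zero.const_add (1 : ℝ)
  have h3 : Tendsto (fun A : ℝ => (1 + A⁻¹) ^ 6 * (∫ y, g y) ^ 3 / 12 +
      (∫ y, g y) ^ 2 * ((∫ y, g y) - ∫ y in (-A)..A, g y)) atTop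
      (nhds ((∫ y, g y) ^ 3 / 12)) := by
    have := (((h2.pow 6).mul_const ((∫ y, g y) ^ 3)).div_const 12).add
      ((h1.const_sub (∫ y, g y)).const_mul ((∫ y, g y) ^ 2))
    simp only [one_pow, one_mul, sub_self, mul_zero, add_zero] at this
    exact this
  obtain ⟨A, hA, hA0⟩ := ((h3.eventually_lt_const hU).and (eventually_gt_atTop 0)).exists
  have hρ : 1 < 1 + A⁻¹ := by linarith [inv_pos.2 hA0]
  filter_upwards [eventually_upper_bound_aux hg hpos hgi hint hanti hmono hA0 hρ]
    with N ⟨C, hC, hcard, hN⟩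
  exact ⟨C, hC, hcard, hN.trans_lt hA⟩

/-- The one-dimensional Panter–Dite–Zador asymptotics for a unimodal density `g ^ 3`. -/
theorem tendsto_sq_mul_sInf_distortion {g : ℝ → ℝ} (hg : Continuous g) (hpos : ∀ x, 0 < g x)
    (hgi : Integrable g) (hint : ∀ c, Integrable (fun y => (y - c) ^ 2 * g y ^ 3))
    (hanti : AntitoneOn g (Set.Ici 0)) (hmono : MonotoneOn g (Set.Iic 0)) :
    Tendsto (fun N : ℕ => (N : ℝ) ^ 2 * sInf {d : ℝ | ∃ (C : Finset ℝ) (hC : C.Nonempty),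
      C.card ≤ N ∧ d = ∫ y, nearestSq C hC y * g y ^ 3}) atTop
      (nhds ((∫ y, g y) ^ 3 / 12)) := by
  refine tendsto_order.2 ⟨fun L hL => ?_, fun U hU => ?_⟩
  · obtain ⟨L', hL1, hL2⟩ := exists_between hL
    filter_upwards [eventually_lower_bound hg hpos hgi hint hL2, eventually_gt_atTop 0]
      with N hN hN0
    have hNr : (0 : ℝ) < (N : ℝ) ^ 2 := by positivity
    refine hL1.trans_le ?_
    rw [← div_le_iff₀' hNr]
    refine le_csInf ⟨_, {0}, Finset.singleton_nonempty 0, Nat.succ_le_of_lt hN0, rfl⟩ ?_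
    rintro d ⟨C, hC, hcard, rfl⟩
    rw [div_le_iff₀' hNr]
    exact (hN C hC hcard).le
  · filter_upwards [eventually_upper_bound hg hpos hgi hint hanti hmono hU]
      with N ⟨C, hC, hcard, hN⟩
    refine lt_of_le_of_lt (mul_le_mul_of_nonneg_left (csInf_le ⟨0, ?_⟩ ?_) (sq_nonneg _)) hN
    · rintro d ⟨C, hC, -, rfl⟩
      exact integral_nonneg fun y => mul_nonneg (nearestSq_nonneg hC y) (pow_pos (hpos y) 3).le
    · exact ⟨C, hC, hcard, rfl⟩

/-- The cube root of the centered Gaussian density of variance `v`. -/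
noncomputable def gaussianCubeRoot (v : ℝ) (x : ℝ) : ℝ :=
  (√(2 * π * v))⁻¹ ^ (3⁻¹ : ℝ) * rexp (-(6 * v)⁻¹ * x ^ 2)

lemma gaussianCubeRoot_pow (v : NNReal) (x : ℝ) :
    gaussianCubeRoot v x ^ 3 = gaussianPDFReal 0 v x := by
  rw [gaussianCubeRoot, gaussianPDFReal, mul_pow, ← Real.exp_nat_mul, ← Real.rpow_mul_natCast
    (by positivity)]
  norm_num
  left
  rcases eq_or_ne (v : ℝ) 0 with h | h
  · simp [h]
  · field_simp; ring

lemma integral_gaussianCubeRoot_pow {v : ℝ} (hv : 0 < v) :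
    (∫ x, gaussianCubeRoot v x) ^ 3 / 12 = π * √3 / 2 * v := by
  have h1 : √(π / (6 * v)⁻¹) = √3 * √(2 * π * v) := by
    rw [← Real.sqrt_mul (by norm_num)]
    congr 1
    field_simp
    norm_num
  have h2 : 0 < √(2 * π * v) := Real.sqrt_pos.2 (by positivity)
  have h3 : √(2 * π * v) ^ 2 = 2 * π * v := Real.sq_sqrt (by positivity)
  have h4 : √3 ^ 2 = (3 : ℝ) := Real.sq_sqrt (by norm_num)
  simp only [gaussianCubeRoot]
  rw [integral_const_mul, integral_gaussian, h1, mul_pow, ← Real.rpow_mul_natCast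
    (by positivity)]
  norm_num
  calc (√(2 * π * v))⁻¹ * (√3 * √(2 * π * v)) ^ 3 / 12
      = √3 ^ 2 * √3 * √(2 * π * v) ^ 2 / 12 := by field_simp
    _ = π * √3 / 2 * v := by rw [h3, h4]; ring

/-- Zador's high-rate formula for a scalar Gaussian source (equation (17)):
`lim_{R→∞} 2^{2R} D*(R) = (π√3/2) σ²`. -/
theorem stmt7 (σ : ℝ) (hσ : 0 < σ) :
    Filter.Tendsto (fun R : ℕ => (2 : ℝ) ^ (2 * R) * DstarGauss σ R)
      Filter.atTop (nhds (π * Real.sqrt 3 / 2 * σ ^ 2)) := by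
  set v : NNReal := Real.toNNReal (σ ^ 2) with hv
  have hvσ : (v : ℝ) = σ ^ 2 := Real.coe_toNNReal _ (sq_nonneg σ)
  have hvpos : (0 : ℝ) < v := by rw [hvσ]; positivity
  have hv0 : v ≠ 0 := by exact_mod_cast hvpos.ne'
  have hκ : 0 < (√(2 * π * v))⁻¹ ^ (3⁻¹ : ℝ) :=
    Real.rpow_pos_of_pos (inv_pos.2 (Real.sqrt_pos.2 (by positivity))) _
  have hlim := tendsto_sq_mul_sInf_distortion (g := gaussianCubeRoot v)
    (by unfold gaussianCubeRoot; fun_prop)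
    (fun x => mul_pos hκ (Real.exp_pos _))
    ((integrable_exp_neg_mul_sq (by positivity)).const_mul _)
    (fun c => by
      have h := ((memLp_id_gaussianReal (μ := 0) (v := v) 2).sub (memLp_const c)).integrable_sq
      rw [gaussianReal_of_var_ne_zero 0 hv0, integrable_withDensity_iff_integrable_smul'
        (measurable_gaussianPDF 0 v) (Eventually.of_forall fun _ => gaussianPDF_lt_top)] at h
      refine h.congr (Eventually.of_forall fun y => ?_)
      simp [toReal_gaussianPDF, gaussianCubeRoot_pow, mul_comm])
    (fun x hx y hy hxy => mul_le_mul_of_nonneg_left (Real.exp_le_exp.2 (by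
      have := mul_le_mul_of_nonneg_left (pow_le_pow_left₀ hx hxy 2)
        (inv_pos.2 (by positivity : (0 : ℝ) < 6 * v)).le
      linarith)) hκ.le)
    (fun x hx y hy hxy => mul_le_mul_of_nonneg_left (Real.exp_le_exp.2 (by
      have hsq : y ^ 2 ≤ x ^ 2 := by
        simp only [Set.mem_Iic] at hx hy
        nlinarith
      have := mul_le_mul_of_nonneg_left hsq (inv_pos.2 (by positivity : (0 : ℝ) < 6 * v)).le
      linarith)) hκ.le)
  rw [integral_gaussianCubeRoot_pow hvpos] at hlim
  rw [← hvσ]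
  refine (hlim.comp (tendsto_pow_atTop_atTop_of_one_lt one_lt_two)).congr fun R => ?_
  simp only [Function.comp_apply, DstarGauss, ← hv, integral_gaussianReal_eq_integral_smul hv0,
    gaussianCubeRoot_pow, nearestSq, smul_eq_mul]
  push_cast
  rw [← pow_mul, mul_comm R 2]
  simp only [mul_comm]
end
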